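/- (Almost exact recovery, achievability.) In the Gaussian contextual graph matching model with parameters (n,d,ρ,η), if d = ω(log n) and there exists ε > 0 such that for all sufficiently large n, ρ²n/(1−ρ²) + 2η²d/(1−η²) ≥ 4(1+ε) log n, then there exists an estimator π̂ : (A,B,X,Y) → S_n such that for every δ ∈ (0,1), P(ov(π̂, π*) > δ) = 1 − o(1) as n → ∞. -/

import Mathlib

open MeasureTheory ProbabilityTheory Real Filter Finset Topology

noncomputable section

namespace CGM

/-- array of (potential) edge weights of a graph on `n` vertices -/
abbrev GW (n : ℕ) := Fin n → Fin n → ℝ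

/-- array of feature values: `n` users, `d` features each -/
abbrev FW (n d : ℕ) := Fin n → Fin d → ℝ

/-- latent sample space: (graph weights, graph noise, features, feature noise) -/
abbrev Samp (n d : ℕ) := (GW n × GW n) × (FW n d × FW n d)

/-- i.i.d. standard Gaussian array (graph part) -/
def stdGaussG (n : ℕ) : Measure (GW n) :=
  Measure.pi fun _ => Measure.pi fun _ => gaussianReal 0 1

/-- i.i.d. standard Gaussian array (feature part) -/
def stdGaussF (n d : ℕ) : Measure (FW n d) :=
  Measure.pi fun _ => Measure.pi fun _ => gaussianReal 0 1

/-- law of the latent randomness of the model -/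
def μ (n d : ℕ) : Measure (Samp n d) :=
  ((stdGaussG n).prod (stdGaussG n)).prod ((stdGaussF n d).prod (stdGaussF n d))

/-- symmetrization of an array, so that only the upper-triangular part matters -/
def sym {n : ℕ} (f : GW n) : GW n := fun i j => if i ≤ j then f i j else f j i

variable {n d : ℕ}

/-- the weighted adjacency matrix `A` -/
def Amat (ω : Samp n d) : GW n := sym ω.1.1

/-- the weighted adjacency matrix `B` (before relabeling by `π*`, i.e. conditionally
on `π* = id`): each pair `(A i j, B i j)`, `i < j`, is bivariate centered Gaussian
with unit variances and correlation `ρ`. -/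
def Bmat (ρ : ℝ) (ω : Samp n d) : GW n :=
  fun i j => ρ * Amat ω i j + Real.sqrt (1 - ρ ^ 2) * sym ω.1.2 i j

/-- the feature matrix `X` -/
def Xmat (ω : Samp n d) : FW n d := ω.2.1

/-- the feature matrix `Y` (conditionally on `π* = id`): each pair `(X i j, Y i j)` is
bivariate centered Gaussian with unit variances and correlation `η`. -/
def Ymat (η : ℝ) (ω : Samp n d) : FW n d :=
  fun i j => η * ω.2.1 i j + Real.sqrt (1 - η ^ 2) * ω.2.2 i j

/-- the ordered pairs `i < j` whose unordered pair `{i,j}` is moved by `φ`;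
its cardinality is `|D^E_φ|`. -/
def movedEdges (φ : Equiv.Perm (Fin n)) : Finset (Fin n × Fin n) :=
  Finset.univ.filter fun p =>
    p.1 < p.2 ∧ ¬((φ p.1 = p.1 ∧ φ p.2 = p.2) ∨ (φ p.1 = p.2 ∧ φ p.2 = p.1))

/-- `V*_G(φ) = Σ_{{i,j} ∈ D^E_φ} B_{ij} A_{ij}` -/
def VGstar (ρ : ℝ) (φ : Equiv.Perm (Fin n)) (ω : Samp n d) : ℝ :=
  ∑ p ∈ movedEdges φ, Bmat ρ ω p.1 p.2 * Amat ω p.1 p.2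

/-- `V_G(φ) = Σ_{{i,j} ∈ D^E_φ} B_{φ(i,j)} A_{ij}` -/
def VG (ρ : ℝ) (φ : Equiv.Perm (Fin n)) (ω : Samp n d) : ℝ :=
  ∑ p ∈ movedEdges φ, Bmat ρ ω (φ p.1) (φ p.2) * Amat ω p.1 p.2

/-- `V*_F(φ) = Σ_{i ∈ D_φ, j ≤ d} Y_{ij} X_{ij}` -/
def VFstar (η : ℝ) (φ : Equiv.Perm (Fin n)) (ω : Samp n d) : ℝ :=
  ∑ i ∈ φ.support, ∑ j, Ymat η ω i j * Xmat ω i j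

/-- `V_F(φ) = Σ_{i ∈ D_φ, j ≤ d} Y_{φ(i),j} X_{ij}` -/
def VF (η : ℝ) (φ : Equiv.Perm (Fin n)) (ω : Samp n d) : ℝ :=
  ∑ i ∈ φ.support, ∑ j, Ymat η ω (φ i) j * Xmat ω i j

/-- the Hamiltonian `V(φ)` -/
def V (ρ η : ℝ) (φ : Equiv.Perm (Fin n)) (ω : Samp n d) : ℝ :=
  ρ / (1 - ρ ^ 2) * (VGstar ρ φ ω - VG ρ φ ω)
    + η / (1 - η ^ 2) * (VFstar η φ ω - VF η φ ω)

/-- the partition function `Z = Σ_φ exp(−V(φ))` -/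
def Zpart (ρ η : ℝ) (ω : Samp n d) : ℝ :=
  ∑ φ : Equiv.Perm (Fin n), Real.exp (-(V ρ η φ ω))

end CGM

namespace CGM

instance permMeasurableSpace (n : ℕ) : MeasurableSpace (Equiv.Perm (Fin n)) := ⊤

/-- the uniform distribution on permutations of `[n]` -/
def unifPerm (n : ℕ) : Measure (Equiv.Perm (Fin n)) :=
  (PMF.uniformOfFintype (Equiv.Perm (Fin n))).toMeasure

/-- sample space of the (unconditioned) model: latent randomness together with the
uniformly random hidden permutation `π*` -/
abbrev SampU (n d : ℕ) := Samp n d × Equiv.Perm (Fin n)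

/-- law of the (unconditioned) model -/
def μU (n d : ℕ) : Measure (SampU n d) := (μ n d).prod (unifPerm n)

/-- the hidden permutation `π*` -/
def πstar {n d : ℕ} (ω : SampU n d) : Equiv.Perm (Fin n) := ω.2

/-- type of the observed data `(A, B, X, Y)` -/
abbrev Obs (n d : ℕ) := GW n × GW n × FW n d × FW n d

/-- the observed data: `A`, `B` (with rows/columns relabeled by `π*`), `X`,
`Y` (with rows relabeled by `π*`), so that `B_{π*(i),π*(j)}` is `ρ`-correlated with
`A_{ij}` and `Y_{π*(i),j}` is `η`-correlated with `X_{ij}`. -/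
def obs {n d : ℕ} (ρ η : ℝ) (ω : SampU n d) : Obs n d :=
  (Amat ω.1,
   fun i j => Bmat ρ ω.1 (ω.2⁻¹ i) (ω.2⁻¹ j),
   Xmat ω.1,
   fun i j => Ymat η ω.1 (ω.2⁻¹ i) j)

/-- the overlap `ov(φ,φ') = |{i : φ(i) = φ'(i)}| / n` between two permutations -/
def ov {n : ℕ} (φ φ' : Equiv.Perm (Fin n)) : ℝ :=
  ((Finset.univ.filter fun i => φ i = φ' i).card : ℝ) / n

end CGM

namespace CGM

section GaussianChaos

variable {ι : Type*} [Fintype ι]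

/-- The product of standard Gaussian measures on `ι → ℝ`. -/
abbrev stdGauss (ι : Type*) [Fintype ι] : Measure (ι → ℝ) :=
  Measure.pi fun _ => gaussianReal 0 1

lemma lintegral_prod_stdGauss {f : ι → ℝ → ENNReal} (hf : ∀ i, Measurable (f i)) :
    ∫⁻ x, ∏ i, f i (x i) ∂stdGauss ι = ∏ i, ∫⁻ y, f i y ∂gaussianReal 0 1 := by
  rw [lintegral_prod_eq_prod_lintegral_of_indepFun (μ := stdGauss ι) Finset.univ
    (fun i x => f i (x i)) (iIndepFun_pi fun i => (hf i).aemeasurable)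
    fun i => (hf i).comp (measurable_pi_apply i)]
  refine Finset.prod_congr rfl fun i _ => ?_
  exact (measurePreserving_eval (fun _ : ι => gaussianReal 0 1) i).lintegral_comp (hf i)

lemma lintegral_exp_mul_gaussianReal (t : ℝ) :
    ∫⁻ x, ENNReal.ofReal (exp (t * x)) ∂gaussianReal 0 1 = ENNReal.ofReal (exp (t ^ 2 / 2)) := by
  rw [← ofReal_integral_eq_lintegral_ofReal (integrable_exp_mul_gaussianReal t)
    (ae_of_all _ fun _ => (exp_pos _).le)]
  have h := mgf_gaussianReal (p := gaussianReal 0 1) (X := id) (μ := 0) (v := 1) (by simp) t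
  simp only [mgf, id] at h
  rw [h]
  simp

/-- Moment generating function of a linear form in independent standard Gaussians. -/
lemma lintegral_exp_linear_stdGauss (u : ι → ℝ) :
    ∫⁻ x, ENNReal.ofReal (exp (∑ i, u i * x i)) ∂stdGauss ι =
      ENNReal.ofReal (exp ((∑ i, u i ^ 2) / 2)) := by
  simp_rw [Real.exp_sum, ENNReal.ofReal_prod_of_nonneg fun i _ => (exp_pos _).le]
  rw [lintegral_prod_stdGauss (f := fun i y => ENNReal.ofReal (exp (u i * y)))
    fun i => by fun_prop]
  simp_rw [lintegral_exp_mul_gaussianReal, Finset.sum_div, Real.exp_sum]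
  rw [ENNReal.ofReal_prod_of_nonneg fun i _ => (exp_pos _).le]

lemma inv_sqrt_one_sub_le {l : ℝ} (hl : |l| ≤ 1 / 4) :
    √((1 - 2 * l)⁻¹) ≤ exp (l + 4 * l ^ 2) := by
  have h1 : |2 * l| ≤ 1 / 2 := by rw [abs_mul, abs_two]; linarith
  have h2 := abs_log_sub_add_sum_range_le (x := 2 * l) (by linarith) 1
  simp only [Finset.sum_range_one, zero_add, pow_one, Nat.cast_zero, div_one, one_add_one_eq_two] at h2
  have h3 : |2 * l| ^ 2 / (1 - |2 * l|) ≤ 2 * (2 * l) ^ 2 := by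
    rw [div_le_iff₀ (by linarith), ← sq_abs (2 * l)]
    generalize |2 * l| = u at h1
    nlinarith [mul_nonneg (sq_nonneg u) (sub_nonneg.2 h1)]
  have h4 := (abs_le.1 (h2.trans h3)).1
  have hpos : 0 < 1 - 2 * l := by linarith [(abs_le.1 h1).2]
  rw [Real.sqrt_le_left (exp_pos _).le, ← Real.exp_nat_mul, ← Real.log_le_iff_le_exp (by positivity),
    Real.log_inv]
  push_cast
  nlinarith

lemma lintegral_exp_sq_gaussianReal_le {l : ℝ} (hl : |l| ≤ 1 / 4) :
    ∫⁻ x, ENNReal.ofReal (exp (l * x ^ 2)) ∂gaussianReal 0 1 ≤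
      ENNReal.ofReal (exp (l + 4 * l ^ 2)) := by
  have hpos : 0 < 1 / 2 - l := by linarith [(abs_le.1 hl).2]
  have h1 : ∀ x : ℝ, gaussianPDF 0 1 x * ENNReal.ofReal (exp (l * x ^ 2)) =
      ENNReal.ofReal ((√(2 * π))⁻¹ * exp (-(1 / 2 - l) * x ^ 2)) := by
    intro x
    rw [gaussianPDF, ← ENNReal.ofReal_mul (gaussianPDFReal_nonneg _ _ _), gaussianPDFReal]
    congr 1
    rw [mul_assoc, ← Real.exp_add]
    simp only [NNReal.coe_one, mul_one, sub_zero]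
    ring_nf
  rw [gaussianReal_of_var_ne_zero _ one_ne_zero,
    lintegral_withDensity_eq_lintegral_mul _ (measurable_gaussianPDF _ _) (by fun_prop)]
  simp only [Pi.mul_apply, h1]
  rw [← ofReal_integral_eq_lintegral_ofReal ((integrable_exp_neg_mul_sq hpos).const_mul _)
    (ae_of_all _ fun _ => by positivity), integral_const_mul, integral_gaussian]
  refine ENNReal.ofReal_le_ofReal (le_trans (le_of_eq ?_) (inv_sqrt_one_sub_le hl))
  rw [← Real.sqrt_inv, ← Real.sqrt_mul (by positivity)]
  congr 1
  have : 1 - 2 * l ≠ 0 := by linarith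
  have : 1 / 2 - l ≠ 0 := hpos.ne'
  field_simp

end GaussianChaos

section QuadraticForm

variable {ι : Type*} [Fintype ι]

/-- Exponential moment of a symmetric quadratic form in independent standard Gaussians. -/
lemma lintegral_exp_symm_quadratic_le [DecidableEq ι] {S : Matrix ι ι ℝ} (hS : S.IsHermitian)
    (hr : ∀ x : ι → ℝ, |x ⬝ᵥ S.mulVec x| ≤ 1 / 4 * (x ⬝ᵥ x)) :
    ∫⁻ x, ENNReal.ofReal (exp (x ⬝ᵥ S.mulVec x)) ∂stdGauss ι ≤
      ENNReal.ofReal (exp (S.trace + 4 * ∑ i, ∑ j, S i j ^ 2)) := by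
  classical
  set b := hS.eigenvectorBasis with hb
  set l := hS.eigenvalues with hl
  have hmul : ∀ j, S.mulVec (b j) = l j • (b j : ι → ℝ) := hS.mulVec_eigenvectorBasis
  have hdot : ∀ i j, (b i : ι → ℝ) ⬝ᵥ b j = if i = j then 1 else 0 := by
    intro i j
    have h := orthonormal_iff_ite.1 b.orthonormal j i
    rw [EuclideanSpace.inner_eq_star_dotProduct] at h
    simpa [eq_comm] using h
  have hlbound : ∀ i, |l i| ≤ 1 / 4 := by
    intro i
    have h := hr (b i)
    rw [hmul, dotProduct_smul, hdot] at h
    simpa using h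
  have hsq : ∑ i, l i ^ 2 = ∑ i, ∑ j, S i j ^ 2 := by
    have h1 : ∀ i, l i ^ 2 = ∑ j, (S j ⬝ᵥ b i) ^ 2 := by
      intro i
      have h : (S.mulVec (b i)) ⬝ᵥ (S.mulVec (b i)) = l i ^ 2 := by
        rw [hmul, dotProduct_smul, smul_dotProduct, hdot]
        simp [sq]
      rw [← h]
      simp [dotProduct, Matrix.mulVec, sq]
    have h2 : ∀ j, ∑ i, (S j ⬝ᵥ b i) ^ 2 = ∑ i, S j i ^ 2 := by
      intro j
      have h := b.sum_sq_norm_inner_right (WithLp.toLp 2 (S j))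
      rw [EuclideanSpace.norm_sq_eq] at h
      simpa [EuclideanSpace.inner_eq_star_dotProduct] using h
    simp_rw [h1]
    rw [Finset.sum_comm]
    simp_rw [h2]
  have htr : S.trace = ∑ i, l i := by
    simpa using hS.trace_eq_sum_eigenvalues
  have hquad : ∀ y : ι → ℝ, (∑ i, y i • (b i : ι → ℝ)) ⬝ᵥ S.mulVec (∑ i, y i • (b i : ι → ℝ)) =
      ∑ i, l i * y i ^ 2 := by
    intro y
    simp_rw [Matrix.mulVec_sum, Matrix.mulVec_smul, hmul, sum_dotProduct, dotProduct_sum,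
      dotProduct_smul, smul_dotProduct, hdot]
    simp
    exact Finset.sum_congr rfl fun i _ => by ring
  have hF : Measurable fun x : EuclideanSpace ℝ ι =>
      ENNReal.ofReal (exp ((x : ι → ℝ) ⬝ᵥ S.mulVec x)) := by
    simp only [dotProduct, Matrix.mulVec]
    fun_prop
  have hrot : ∫⁻ x, ENNReal.ofReal (exp (x ⬝ᵥ S.mulVec x)) ∂stdGauss ι =
      ∫⁻ y, ENNReal.ofReal (exp (∑ i, l i * y i ^ 2)) ∂stdGauss ι := by
    have h1 := lintegral_map (μ := stdGauss ι) hF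
      (show Measurable (WithLp.toLp 2 : (ι → ℝ) → EuclideanSpace ℝ ι) by fun_prop)
    have h2 := lintegral_map (μ := stdGauss ι) hF
      (show Measurable fun y : ι → ℝ => ∑ i, y i • b i by fun_prop)
    rw [map_pi_eq_stdGaussian, stdGaussian_eq_map_pi_orthonormalBasis b, h2] at h1
    rw [← h1]
    refine lintegral_congr fun y => ?_
    rw [← hquad y]
    simp
  rw [hrot]
  simp_rw [Real.exp_sum, ENNReal.ofReal_prod_of_nonneg fun i _ => (exp_pos _).le]
  rw [lintegral_prod_stdGauss (f := fun i y => ENNReal.ofReal (exp (l i * y ^ 2)))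
    fun i => by fun_prop, htr, ← hsq, Finset.mul_sum, ← Finset.sum_add_distrib, Real.exp_sum,
    ENNReal.ofReal_prod_of_nonneg fun i _ => (exp_pos _).le]
  exact Finset.prod_le_prod' fun i _ => lintegral_exp_sq_gaussianReal_le (hlbound i)

/-- Exponential moment of a quadratic form in independent standard Gaussians. -/
lemma lintegral_exp_quadratic_le [DecidableEq ι] (N : Matrix ι ι ℝ)
    (hr : ∀ x : ι → ℝ, |x ⬝ᵥ N.mulVec x| ≤ 1 / 4 * (x ⬝ᵥ x)) :
    ∫⁻ x, ENNReal.ofReal (exp (x ⬝ᵥ N.mulVec x)) ∂stdGauss ι ≤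
      ENNReal.ofReal (exp (N.trace + 4 * ∑ i, ∑ j, N i j ^ 2)) := by
  set S : Matrix ι ι ℝ := (1 / 2 : ℝ) • (N + N.transpose) with hSdef
  have hS : S.IsHermitian := by
    ext i j
    simp [hSdef, add_comm]
  have hq : ∀ x : ι → ℝ, x ⬝ᵥ S.mulVec x = x ⬝ᵥ N.mulVec x := by
    intro x
    have : x ⬝ᵥ N.transpose.mulVec x = x ⬝ᵥ N.mulVec x := by
      rw [Matrix.mulVec_transpose, dotProduct_comm, Matrix.dotProduct_mulVec]
    rw [hSdef, Matrix.smul_mulVec, dotProduct_smul, Matrix.add_mulVec, dotProduct_add, this]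
    simp only [smul_eq_mul]
    ring
  have htr : S.trace = N.trace := by
    rw [hSdef, Matrix.trace_smul, Matrix.trace_add, Matrix.trace_transpose]
    simp only [smul_eq_mul]
    ring
  have hfrob : ∑ i, ∑ j, S i j ^ 2 ≤ ∑ i, ∑ j, N i j ^ 2 := by
    have h1 : ∀ i j, S i j ^ 2 ≤ 1 / 2 * N i j ^ 2 + 1 / 2 * N j i ^ 2 := by
      intro i j
      simp only [hSdef, Matrix.smul_apply, Matrix.add_apply, Matrix.transpose_apply, smul_eq_mul]
      nlinarith [sq_nonneg (N i j - N j i)]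
    refine (Finset.sum_le_sum fun i _ => Finset.sum_le_sum fun j _ => h1 i j).trans (le_of_eq ?_)
    simp_rw [Finset.sum_add_distrib, ← Finset.mul_sum]
    rw [Finset.sum_comm (f := fun i j => N j i ^ 2)]
    ring
  have h := lintegral_exp_symm_quadratic_le hS fun x => by rw [hq]; exact hr x
  simp_rw [hq] at h
  refine h.trans (ENNReal.ofReal_le_ofReal (Real.exp_le_exp.2 ?_))
  rw [htr]
  linarith

end QuadraticForm

section Matching

variable {T : Type*}

/-- The correlation form pairing the entry `e ∈ E` of a Gaussian array with the entry `f e` of a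
`ρ`-correlated copy. -/
def corrForm (E : Finset T) (f : T → T) (ρ : ℝ) (z : (T → ℝ) × (T → ℝ)) : ℝ :=
  ∑ e ∈ E, (ρ * z.1 (f e) + √(1 - ρ ^ 2) * z.2 (f e)) * z.1 e

lemma measurable_corrForm (E : Finset T) (f : T → T) (ρ : ℝ) : Measurable (corrForm E f ρ) := by
  unfold corrForm
  fun_prop

variable [Fintype T] [DecidableEq T]

lemma lintegral_exp_sum_comp_stdGauss (E : Finset T) {f : T → T} (hf : Set.InjOn f E)
    (v : T → ℝ) :
    ∫⁻ y, ENNReal.ofReal (exp (∑ e ∈ E, v e * y (f e))) ∂stdGauss T =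
      ENNReal.ofReal (exp ((∑ e ∈ E, v e ^ 2) / 2)) := by
  set u : T → ℝ := fun t => ∑ e ∈ E, if f e = t then v e else 0 with hu
  have h1 : ∀ y : T → ℝ, ∑ e ∈ E, v e * y (f e) = ∑ t, u t * y t := by
    intro y
    simp_rw [hu, Finset.sum_mul]
    rw [Finset.sum_comm]
    simp
  have h2 : ∑ t, u t ^ 2 = ∑ e ∈ E, v e ^ 2 := by
    have h3 : ∀ e ∈ E, u (f e) = v e := by
      intro e he
      simp only [hu]
      rw [Finset.sum_eq_single_of_mem e he fun e' he' hne =>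
        if_neg fun h => hne (hf he' he h)]
      simp
    have h4 := h1 u
    simp_rw [← sq] at h4
    rw [← h4]
    exact Finset.sum_congr rfl fun e he => by rw [h3 e he, sq]
  simp_rw [h1, lintegral_exp_linear_stdGauss, h2]

lemma lintegral_exp_corrForm_le (E : Finset T) {f : T → T} (hf : Set.InjOn f E) {c ρ : ℝ}
    (hc : |c| ≤ 1 / 8) (hρ : |ρ| ≤ 1) :
    ∫⁻ z, ENNReal.ofReal (exp (c * corrForm E f ρ z)) ∂(stdGauss T).prod (stdGauss T) ≤
      ENNReal.ofReal (exp (c * ρ * #{e ∈ E | f e = e} +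
        (c ^ 2 / 2 + 8 * c ^ 2 * ρ ^ 2 + 2 * c ^ 4) * #E)) := by
  set h : ℝ := c ^ 2 * (1 - ρ ^ 2) / 2 with hh
  have hρ2 : ρ ^ 2 ≤ 1 := by rw [← sq_abs]; exact pow_le_one₀ (abs_nonneg _) hρ
  have hh0 : 0 ≤ h := by
    have := mul_nonneg (sq_nonneg c) (sub_nonneg.2 hρ2)
    rw [hh]; linarith
  have hh1 : h ≤ c ^ 2 / 2 := by
    have := mul_nonneg (sq_nonneg c) (sq_nonneg ρ)
    rw [hh]; nlinarith
  have hc2 : c ^ 2 ≤ 1 / 64 := by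
    rw [← sq_abs]
    nlinarith [abs_nonneg c]
  have hcρ : |c * ρ| ≤ 1 / 8 := by
    rw [abs_mul]
    exact (mul_le_mul hc hρ (abs_nonneg _) (by norm_num)).trans (by norm_num)
  set N : Matrix T T ℝ := fun e t =>
    if e ∈ E then (if t = f e then c * ρ else 0) + (if t = e then h else 0) else 0 with hN
  have hquad : ∀ x : T → ℝ, x ⬝ᵥ N.mulVec x = ∑ e ∈ E, (c * ρ * (x (f e) * x e) + h * x e ^ 2) := by
    intro x
    have : ∀ e, x e * N.mulVec x e =
        if e ∈ E then (c * ρ * (x (f e) * x e) + h * x e ^ 2) else 0 := by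
      intro e
      by_cases he : e ∈ E
      · simp [hN, Matrix.mulVec, dotProduct, he, add_mul, Finset.sum_add_distrib]
        ring
      · simp [hN, Matrix.mulVec, dotProduct, he]
    simp_rw [dotProduct, this]
    simp
  have hinner : ∀ x : T → ℝ,
      ∫⁻ y, ENNReal.ofReal (exp (c * corrForm E f ρ (x, y))) ∂stdGauss T =
        ENNReal.ofReal (exp (x ⬝ᵥ N.mulVec x)) := by
    intro x
    have h1 : ∀ y : T → ℝ, ENNReal.ofReal (exp (c * corrForm E f ρ (x, y))) =
        ENNReal.ofReal (exp (c * ρ * ∑ e ∈ E, x (f e) * x e)) *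
          ENNReal.ofReal (exp (∑ e ∈ E, (c * √(1 - ρ ^ 2) * x e) * y (f e))) := by
      intro y
      rw [← ENNReal.ofReal_mul (exp_pos _).le, ← Real.exp_add]
      congr 2
      simp_rw [corrForm, Finset.mul_sum]
      rw [← Finset.sum_add_distrib]
      exact Finset.sum_congr rfl fun e _ => by ring
    simp_rw [h1]
    rw [lintegral_const_mul _ (by fun_prop), lintegral_exp_sum_comp_stdGauss E hf,
      ← ENNReal.ofReal_mul (exp_pos _).le, ← Real.exp_add, hquad]
    congr 2
    rw [Finset.sum_add_distrib, ← Finset.mul_sum, ← Finset.mul_sum, Finset.sum_div,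
      Finset.mul_sum (a := h)]
    congr 1
    refine Finset.sum_congr rfl fun e _ => ?_
    rw [mul_pow, mul_pow, Real.sq_sqrt (sub_nonneg.2 hρ2), hh]
    ring
  have hr : ∀ x : T → ℝ, |x ⬝ᵥ N.mulVec x| ≤ 1 / 4 * (x ⬝ᵥ x) := by
    intro x
    have hE : ∑ e ∈ E, x e ^ 2 ≤ ∑ t, x t ^ 2 :=
      Finset.sum_le_univ_sum_of_nonneg fun t => sq_nonneg _
    have hfE : ∑ e ∈ E, x (f e) ^ 2 ≤ ∑ t, x t ^ 2 := by
      rw [← Finset.sum_image (g := f) (f := fun t => x t ^ 2) hf]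
      exact Finset.sum_le_univ_sum_of_nonneg fun t => sq_nonneg _
    have hterm : ∀ e ∈ E, |c * ρ * (x (f e) * x e) + h * x e ^ 2| ≤
        1 / 16 * x (f e) ^ 2 + 1 / 8 * x e ^ 2 := by
      intro e _
      have h1 : |c * ρ * (x (f e) * x e)| ≤ 1 / 8 * ((x (f e) ^ 2 + x e ^ 2) / 2) := by
        rw [abs_mul]
        refine mul_le_mul hcρ ?_ (abs_nonneg _) (by norm_num)
        rw [abs_le]
        constructor <;> nlinarith [sq_nonneg (x (f e) + x e), sq_nonneg (x (f e) - x e)]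
      have h2 : |h * x e ^ 2| ≤ 1 / 16 * x e ^ 2 := by
        rw [abs_of_nonneg (mul_nonneg hh0 (sq_nonneg _))]
        exact mul_le_mul_of_nonneg_right (by linarith) (sq_nonneg _)
      refine (abs_add_le _ _).trans ?_
      linarith
    have hxx : x ⬝ᵥ x = ∑ t, x t ^ 2 := by simp [dotProduct, sq]
    rw [hquad, hxx]
    refine (Finset.abs_sum_le_sum_abs _ _).trans ((Finset.sum_le_sum hterm).trans ?_)
    rw [Finset.sum_add_distrib, ← Finset.mul_sum, ← Finset.mul_sum]
    have : 0 ≤ ∑ t, x t ^ 2 := Finset.sum_nonneg fun t _ => sq_nonneg _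
    linarith
  have htr : N.trace = c * ρ * #{e ∈ E | f e = e} + h * #E := by
    have h1 : ∀ e, N e e = if e ∈ E then (if f e = e then c * ρ else 0) + h else 0 := by
      intro e
      simp [hN, eq_comm]
    simp_rw [Matrix.trace, Matrix.diag, h1]
    rw [Finset.sum_ite_mem, Finset.univ_inter, Finset.sum_add_distrib, ← Finset.sum_filter]
    simp [mul_comm]
  have hfrob : ∑ i, ∑ j, N i j ^ 2 ≤ (2 * c ^ 2 * ρ ^ 2 + 2 * h ^ 2) * #E := by
    have h1 : ∀ i, ∑ j, N i j ^ 2 ≤ if i ∈ E then 2 * c ^ 2 * ρ ^ 2 + 2 * h ^ 2 else 0 := by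
      intro i
      split_ifs with hi
      · have h2 : ∀ j, N i j ^ 2 ≤
            (if j = f i then 2 * c ^ 2 * ρ ^ 2 else 0) + (if j = i then 2 * h ^ 2 else 0) := by
          intro j
          simp only [hN, if_pos hi]
          split_ifs
          · nlinarith [sq_nonneg (c * ρ - h)]
          · nlinarith [sq_nonneg (c * ρ)]
          · nlinarith [sq_nonneg h]
          · simp
        refine (Finset.sum_le_sum fun j _ => h2 j).trans (le_of_eq ?_)
        rw [Finset.sum_add_distrib]
        simp
      · simp [hN, hi]
    refine (Finset.sum_le_sum fun i _ => h1 i).trans (le_of_eq ?_)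
    rw [Finset.sum_ite_mem, Finset.univ_inter, Finset.sum_const, nsmul_eq_mul, mul_comm]
  rw [lintegral_prod _ ((measurable_corrForm E f ρ).const_mul c).exp.ennreal_ofReal.aemeasurable]
  simp_rw [hinner]
  refine (lintegral_exp_quadratic_le N hr).trans
    (ENNReal.ofReal_le_ofReal (Real.exp_le_exp.2 ?_))
  have hh2 : h ^ 2 ≤ c ^ 4 / 4 := by nlinarith
  have hcoef : h + 4 * (2 * c ^ 2 * ρ ^ 2 + 2 * h ^ 2) ≤
      c ^ 2 / 2 + 8 * c ^ 2 * ρ ^ 2 + 2 * c ^ 4 := by linarith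
  have hE : (0 : ℝ) ≤ #E := Nat.cast_nonneg _
  rw [htr]
  nlinarith [mul_le_mul_of_nonneg_right hcoef hE]

end Matching

section Model

lemma measurePreserving_uncurry_stdGauss (ι κ : Type*) [Fintype ι] [Fintype κ] :
    MeasurePreserving (Function.uncurry : (ι → κ → ℝ) → ι × κ → ℝ)
      (Measure.pi fun _ => stdGauss κ) (stdGauss (ι × κ)) := by
  refine ⟨measurable_uncurry, (Measure.pi_eq fun s hs => ?_).symm⟩
  have hpre : (Function.uncurry : (ι → κ → ℝ) → ι × κ → ℝ) ⁻¹' (Set.univ.pi s) =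
      Set.univ.pi fun i => Set.univ.pi fun j => s (i, j) := by
    ext x
    simp [Function.uncurry_def]
  rw [Measure.map_apply measurable_uncurry (MeasurableSet.univ_pi hs), hpre, Measure.pi_pi]
  simp_rw [Measure.pi_pi]
  rw [Fintype.prod_prod_type]

variable {n d : ℕ}

instance : IsProbabilityMeasure (stdGaussG n) := by unfold stdGaussG; infer_instance

instance : IsProbabilityMeasure (stdGaussF n d) := by unfold stdGaussF; infer_instance

instance : IsProbabilityMeasure (μ n d) := by unfold μ; infer_instance

/-- The ordered pairs `i < j` with at least one endpoint in `D`. -/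
def incidentPairs (D : Finset (Fin n)) : Finset (Fin n × Fin n) :=
  Finset.univ.filter fun p => p.1 < p.2 ∧ (p.1 ∈ D ∨ p.2 ∈ D)

/-- The increasing ordering of the image of a pair under `φ`. -/
def sortedImage (φ : Equiv.Perm (Fin n)) (p : Fin n × Fin n) : Fin n × Fin n :=
  if φ p.1 ≤ φ p.2 then (φ p.1, φ p.2) else (φ p.2, φ p.1)

/-- The part of the weighted alignment score of `φ` that involves vertices of `D`. -/
def score (a b ρ η : ℝ) (D : Finset (Fin n)) (φ : Equiv.Perm (Fin n)) (ω : Samp n d) : ℝ :=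
  a * ∑ p ∈ incidentPairs D, Bmat ρ ω (φ p.1) (φ p.2) * Amat ω p.1 p.2 +
    b * ∑ i ∈ D, ∑ j, Ymat η ω (φ i) j * Xmat ω i j

lemma sortedImage_injOn (φ : Equiv.Perm (Fin n)) (D : Finset (Fin n)) :
    Set.InjOn (sortedImage φ) (incidentPairs D) := by
  rintro ⟨i, j⟩ hp ⟨k, l⟩ hq h
  simp only [incidentPairs, Finset.coe_filter, Finset.mem_univ, true_and, Set.mem_ofPred_eq] at hp hq
  simp only [sortedImage] at h
  split_ifs at h <;> simp only [Prod.mk.injEq, EmbeddingLike.apply_eq_iff_eq] at h ⊢ <;> grind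

lemma sum_incidentPairs_eq_corrForm (ρ : ℝ) (D : Finset (Fin n)) (φ : Equiv.Perm (Fin n))
    (ω : Samp n d) :
    ∑ p ∈ incidentPairs D, Bmat ρ ω (φ p.1) (φ p.2) * Amat ω p.1 p.2 =
      corrForm (incidentPairs D) (sortedImage φ) ρ
        (Function.uncurry ω.1.1, Function.uncurry ω.1.2) := by
  refine Finset.sum_congr rfl fun p hp => ?_
  simp only [incidentPairs, Finset.mem_filter] at hp
  have h1 : Amat ω p.1 p.2 = Function.uncurry ω.1.1 p := by
    simp [Amat, sym, hp.2.1.le, Function.uncurry_def]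
  have h2 : ∀ g : GW n, sym g (φ p.1) (φ p.2) = Function.uncurry g (sortedImage φ p) := by
    intro g
    simp only [sym, sortedImage]
    split_ifs <;> rfl
  rw [h1, Bmat, Amat, h2, h2]

lemma sum_features_eq_corrForm (η : ℝ) (D : Finset (Fin n)) (φ : Equiv.Perm (Fin n))
    (ω : Samp n d) :
    ∑ i ∈ D, ∑ j, Ymat η ω (φ i) j * Xmat ω i j =
      corrForm (D ×ˢ Finset.univ) (Prod.map φ id) η
        (Function.uncurry ω.2.1, Function.uncurry ω.2.2) := by
  rw [corrForm, Finset.sum_product]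
  rfl

/-- Exponential moment of the alignment score. -/
lemma lintegral_exp_score_le (D : Finset (Fin n)) (φ : Equiv.Perm (Fin n)) {a b ρ η : ℝ}
    (ha : |a| ≤ 1 / 8) (hb : |b| ≤ 1 / 8) (hρ : |ρ| ≤ 1) (hη : |η| ≤ 1) :
    ∫⁻ ω, ENNReal.ofReal (exp (score a b ρ η D φ ω)) ∂μ n d ≤
      ENNReal.ofReal (exp (
        (a * ρ * #{e ∈ incidentPairs D | sortedImage φ e = e} +
          (a ^ 2 / 2 + 8 * a ^ 2 * ρ ^ 2 + 2 * a ^ 4) * #(incidentPairs D)) +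
        (b * η * #{e ∈ D ×ˢ (Finset.univ : Finset (Fin d)) | Prod.map φ id e = e} +
          (b ^ 2 / 2 + 8 * b ^ 2 * η ^ 2 + 2 * b ^ 4) * #(D ×ˢ (Finset.univ : Finset (Fin d)))))) := by
  have hG : MeasurePreserving (Prod.map Function.uncurry Function.uncurry)
      ((stdGaussG n).prod (stdGaussG n)) ((stdGauss (Fin n × Fin n)).prod (stdGauss _)) :=
    (measurePreserving_uncurry_stdGauss _ _).prod (measurePreserving_uncurry_stdGauss _ _)
  have hF : MeasurePreserving (Prod.map Function.uncurry Function.uncurry)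
      ((stdGaussF n d).prod (stdGaussF n d)) ((stdGauss (Fin n × Fin d)).prod (stdGauss _)) :=
    (measurePreserving_uncurry_stdGauss _ _).prod (measurePreserving_uncurry_stdGauss _ _)
  have hmG : Measurable fun z => ENNReal.ofReal (exp (a *
      corrForm (incidentPairs D) (sortedImage φ) ρ z)) :=
    ((measurable_corrForm _ _ _).const_mul a).exp.ennreal_ofReal
  have hmF : Measurable fun z => ENNReal.ofReal (exp (b *
      corrForm (D ×ˢ (Finset.univ : Finset (Fin d))) (Prod.map φ id) η z)) :=
    ((measurable_corrForm _ _ _).const_mul b).exp.ennreal_ofReal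
  have hinj : Set.InjOn (Prod.map φ (id : Fin d → Fin d))
      (D ×ˢ (Finset.univ : Finset (Fin d)) : Finset _) :=
    (φ.injective.prodMap Function.injective_id).injOn
  simp_rw [score, sum_incidentPairs_eq_corrForm, sum_features_eq_corrForm, Real.exp_add,
    ENNReal.ofReal_mul (exp_pos _).le]
  rw [μ]
  refine (le_of_eq (lintegral_prod_mul (hmG.comp hG.measurable).aemeasurable
    (hmF.comp hF.measurable).aemeasurable)).trans ?_
  simp only [Function.comp_apply]
  rw [hG.lintegral_comp hmG, hF.lintegral_comp hmF]
  have h1 := lintegral_exp_corrForm_le (incidentPairs D) (sortedImage_injOn φ D) ha hρ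
  have h2 := lintegral_exp_corrForm_le _ hinj hb hη
  refine (mul_le_mul' h1 h2).trans (le_of_eq ?_)
  rw [← ENNReal.ofReal_mul (exp_pos _).le, Real.exp_add, Real.exp_add]

lemma card_filter_sortedImage_one (D : Finset (Fin n)) :
    #{e ∈ incidentPairs D | sortedImage 1 e = e} = #(incidentPairs D) := by
  congr 1
  refine Finset.filter_true_of_mem fun p hp => ?_
  simp only [incidentPairs, Finset.mem_filter] at hp
  simp [sortedImage, hp.2.1.le]

lemma card_filter_sortedImage_le (φ : Equiv.Perm (Fin n)) :
    #{e ∈ incidentPairs φ.support | sortedImage φ e = e} ≤ #φ.support := by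
  have key : ∀ p ∈ ({e ∈ incidentPairs φ.support | sortedImage φ e = e} : Finset _),
      φ p.1 = p.2 ∧ p.1 ∈ φ.support := by
    rintro ⟨i, j⟩ hp
    simp only [incidentPairs, Finset.mem_filter, Finset.mem_univ, true_and,
      Equiv.Perm.mem_support, sortedImage] at hp ⊢
    obtain ⟨⟨hlt, hD⟩, hp⟩ := hp
    split_ifs at hp <;> simp only [Prod.mk.injEq] at hp <;> grind
  refine Finset.card_le_card_of_injOn Prod.fst (fun p hp => (key p hp).2) ?_
  intro p hp q hq h
  have h1 := (key p hp).1
  have h2 := (key q hq).1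
  exact Prod.ext h (by rw [← h1, ← h2, h])

lemma card_filter_prodMap_support (φ : Equiv.Perm (Fin n)) :
    #{e ∈ φ.support ×ˢ (Finset.univ : Finset (Fin d)) | Prod.map φ id e = e} = 0 := by
  rw [Finset.card_eq_zero, Finset.filter_eq_empty_iff]
  rintro ⟨i, j⟩ hp
  simp only [Finset.mem_product, Equiv.Perm.mem_support] at hp
  simp [hp.1]

lemma card_mul_le_two_mul_card_incidentPairs (D : Finset (Fin n)) :
    #D * (n - 1) ≤ 2 * #(incidentPairs D) := by
  have h1 : #(D.sigma fun i => Finset.univ.erase i) = #D * (n - 1) := by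
    simp [Finset.card_sigma]
  set s := (D.sigma fun i => (Finset.univ.erase i : Finset (Fin n))) with hs
  have h2 : #{x ∈ s | x.1 < x.2} ≤ #(incidentPairs D) := by
    refine Finset.card_le_card_of_injOn (fun x => (x.1, x.2)) ?_ ?_
    · rintro ⟨i, j⟩ hx
      simp [hs, incidentPairs] at hx ⊢
      tauto
    · rintro ⟨i, j⟩ - ⟨k, l⟩ - h
      simpa using h
  have h3 : #{x ∈ s | ¬ x.1 < x.2} ≤ #(incidentPairs D) := by
    refine Finset.card_le_card_of_injOn (fun x => (x.2, x.1)) ?_ ?_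
    · rintro ⟨i, j⟩ hx
      simp [hs, incidentPairs] at hx ⊢
      exact ⟨lt_of_le_of_ne hx.2 hx.1.2, Or.inr hx.1.1⟩
    · rintro ⟨i, j⟩ - ⟨k, l⟩ - h
      simp at h ⊢
      tauto
  have h4 := Finset.card_filter_add_card_filter_not (s := s) (fun x => x.1 < x.2)
  omega

end Model

section Deviation

/-- Exponential Markov inequality. -/
lemma measure_ge_le_exp_mul_lintegral {Ω : Type*} [MeasurableSpace Ω] (P : Measure Ω) {W : Ω → ℝ}
    (hW : Measurable W) (τ : ℝ) :
    P {ω | τ ≤ W ω} ≤ ENNReal.ofReal (exp (-τ)) * ∫⁻ ω, ENNReal.ofReal (exp (W ω)) ∂P := by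
  have h := mul_meas_ge_le_lintegral (μ := P) hW.exp.ennreal_ofReal (ENNReal.ofReal (exp τ))
  have hset : {ω | τ ≤ W ω} = {ω | ENNReal.ofReal (exp τ) ≤ ENNReal.ofReal (exp (W ω))} := by
    ext ω
    simp [ENNReal.ofReal_le_ofReal_iff (exp_pos _).le]
  rw [← hset] at h
  calc P {ω | τ ≤ W ω}
      = ENNReal.ofReal (exp (-τ)) * (ENNReal.ofReal (exp τ) * P {ω | τ ≤ W ω}) := by
        rw [← mul_assoc, ← ENNReal.ofReal_mul (exp_pos _).le, ← Real.exp_add]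
        simp
    _ ≤ _ := by gcongr

variable {n d : ℕ}

lemma measurable_score (a b ρ η : ℝ) (D : Finset (Fin n)) (φ : Equiv.Perm (Fin n)) :
    Measurable (score a b ρ η D φ : Samp n d → ℝ) := by
  unfold score
  simp_rw [sum_incidentPairs_eq_corrForm, sum_features_eq_corrForm]
  refine (((measurable_corrForm _ _ _).comp ?_).const_mul a).add
    (((measurable_corrForm _ _ _).comp ?_).const_mul b)
  · exact (measurable_uncurry.comp (by fun_prop)).prodMk (measurable_uncurry.comp (by fun_prop))
  · exact (measurable_uncurry.comp (by fun_prop)).prodMk (measurable_uncurry.comp (by fun_prop))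

lemma score_mul_mul (t a b ρ η : ℝ) (D : Finset (Fin n)) (φ : Equiv.Perm (Fin n))
    (ω : Samp n d) : score (t * a) (t * b) ρ η D φ ω = t * score a b ρ η D φ ω := by
  rw [score, score]
  ring

/-- The mean of the score of the true matching restricted to `D`. -/
def signal (d : ℕ) (a b ρ η : ℝ) (D : Finset (Fin n)) : ℝ :=
  a * ρ * #(incidentPairs D) + b * η * (#D * d)

variable {a b ρ η κ : ℝ}

/-- Lower tail of the score of the true matching. -/
lemma measure_score_one_le (D : Finset (Fin n)) (hκ0 : 0 < κ) (hκ : κ ≤ 1 / 8)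
    (ha : |a| ≤ κ) (hb : |b| ≤ κ) (hρ : |ρ| ≤ 1) (hη : |η| ≤ 1)
    (haρ : a ^ 2 ≤ a * ρ) (hbη : b ^ 2 ≤ b * η) :
    μ n d {ω | score a b ρ η D 1 ω ≤ (1 - κ) * signal d a b ρ η D} ≤
      ENNReal.ofReal (exp (-(κ ^ 2 / 44) * signal d a b ρ η D)) := by
  set m := signal d a b ρ η D with hm
  set θ := κ / 22 with hθ
  have hθ0 : 0 < θ := by positivity
  have hθ1 : θ ≤ 1 := by linarith
  have hset : {ω : Samp n d | score a b ρ η D 1 ω ≤ (1 - κ) * m} =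
      {ω | -θ * ((1 - κ) * m) ≤ score (-θ * a) (-θ * b) ρ η D 1 ω} := by
    ext ω
    simp only [score_mul_mul, Set.mem_ofPred_eq]
    constructor <;> intro h <;> nlinarith
  have hsmall : ∀ x : ℝ, |x| ≤ κ → |-θ * x| ≤ 1 / 8 := by
    intro x hx
    rw [abs_mul, abs_neg, abs_of_pos hθ0]
    nlinarith [abs_nonneg x]
  have hcoef : ∀ x r : ℝ, |x| ≤ κ → |r| ≤ 1 → x ^ 2 ≤ x * r →
      -θ * x * r + ((-θ * x) ^ 2 / 2 + 8 * (-θ * x) ^ 2 * r ^ 2 + 2 * (-θ * x) ^ 4) ≤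
        (-θ + 11 * θ ^ 2) * (x * r) := by
    intro x r hx hr hxr
    have hr2 : r ^ 2 ≤ 1 := by rw [← sq_abs]; exact pow_le_one₀ (abs_nonneg _) hr
    have hx2 : x ^ 2 ≤ 1 := by
      rw [← sq_abs]; exact pow_le_one₀ (abs_nonneg _) (by linarith)
    have hθ2 : θ ^ 2 ≤ 1 := pow_le_one₀ hθ0.le hθ1
    have hxt : 0 ≤ θ ^ 2 * x ^ 2 := by positivity
    have h1 : θ ^ 2 * x ^ 2 * r ^ 2 ≤ θ ^ 2 * x ^ 2 := mul_le_of_le_one_right hxt hr2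
    have h2 : θ ^ 2 * x ^ 2 * (θ ^ 2 * x ^ 2) ≤ θ ^ 2 * x ^ 2 :=
      mul_le_of_le_one_right hxt (mul_le_one₀ hθ2 (sq_nonneg _) hx2)
    have h3 : θ ^ 2 * x ^ 2 ≤ θ ^ 2 * (x * r) := mul_le_mul_of_nonneg_left hxr (sq_nonneg _)
    nlinarith
  rw [hset]
  refine (measure_ge_le_exp_mul_lintegral _ (measurable_score _ _ _ _ _ _) _).trans ?_
  refine (mul_le_mul_right (lintegral_exp_score_le D 1 (hsmall a ha) (hsmall b hb) hρ hη) _).trans ?_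
  rw [← ENNReal.ofReal_mul (exp_pos _).le, ← Real.exp_add]
  refine ENNReal.ofReal_le_ofReal (Real.exp_le_exp.2 ?_)
  have hF : #{e ∈ D ×ˢ (Finset.univ : Finset (Fin d)) |
      Prod.map (1 : Equiv.Perm (Fin n)) id e = e} = #(D ×ˢ (Finset.univ : Finset (Fin d))) := by
    simp
  have hcard : (#(D ×ˢ (Finset.univ : Finset (Fin d))) : ℝ) = #D * d := by
    simp [Finset.card_product]
  rw [card_filter_sortedImage_one, hF, hcard]
  have hN : (0 : ℝ) ≤ #(incidentPairs D) := Nat.cast_nonneg _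
  have hK : (0 : ℝ) ≤ #D * d := by positivity
  have h1 := mul_le_mul_of_nonneg_right (hcoef a ρ ha hρ haρ) hN
  have h2 := mul_le_mul_of_nonneg_right (hcoef b η hb hη hbη) hK
  have h3 : κ = 22 * θ := by rw [hθ]; ring
  have h4 : m = a * ρ * #(incidentPairs D) + b * η * (#D * d) := rfl
  rw [h3, h4]
  nlinarith

/-- Upper tail of the score of a wrong matching. -/
lemma measure_score_ge_le (φ : Equiv.Perm (Fin n)) (hκ : κ ≤ 1 / 8)
    (ha : |a| ≤ κ) (hb : |b| ≤ κ) (hρ : |ρ| ≤ 1) (hη : |η| ≤ 1)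
    (haρ : a ^ 2 ≤ a * ρ) (hbη : b ^ 2 ≤ b * η) :
    μ n d {ω | (1 - κ) * signal d a b ρ η φ.support ≤ score a b ρ η φ.support φ ω} ≤
      ENNReal.ofReal (exp (-(1 / 2 - 11 * κ) * signal d a b ρ η φ.support +
        a * ρ * #φ.support)) := by
  have hcoef : ∀ x r : ℝ, |x| ≤ κ → |r| ≤ 1 → x ^ 2 ≤ x * r →
      x ^ 2 / 2 + 8 * x ^ 2 * r ^ 2 + 2 * x ^ 4 ≤ (1 / 2 + 10 * κ) * (x * r) := by
    intro x r hx hr hxr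
    have hxr0 : 0 ≤ x * r := (sq_nonneg x).trans hxr
    have hxr1 : x * r ≤ κ := by
      refine (le_abs_self _).trans ?_
      rw [abs_mul]
      exact (mul_le_of_le_one_right (abs_nonneg _) hr).trans hx
    have h1 : (x * r) * (x * r) ≤ κ * (x * r) := mul_le_mul_of_nonneg_right hxr1 hxr0
    have h2 : x ^ 2 * x ^ 2 ≤ (x * r) * (x * r) := mul_le_mul hxr hxr (sq_nonneg _) hxr0
    nlinarith
  refine (measure_ge_le_exp_mul_lintegral _ (measurable_score _ _ _ _ _ _) _).trans ?_
  refine (mul_le_mul_right (lintegral_exp_score_le φ.support φ (ha.trans hκ) (hb.trans hκ)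
    hρ hη) _).trans ?_
  rw [← ENNReal.ofReal_mul (exp_pos _).le, ← Real.exp_add]
  refine ENNReal.ofReal_le_ofReal (Real.exp_le_exp.2 ?_)
  have hcard : (#(φ.support ×ˢ (Finset.univ : Finset (Fin d))) : ℝ) = #φ.support * d := by
    simp [Finset.card_product]
  rw [card_filter_prodMap_support, hcard, signal]
  have hN : (0 : ℝ) ≤ #(incidentPairs φ.support) := Nat.cast_nonneg _
  have hK : (0 : ℝ) ≤ #φ.support * d := by positivity
  have h1 := mul_le_mul_of_nonneg_right (hcoef a ρ ha hρ haρ) hN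
  have h2 := mul_le_mul_of_nonneg_right (hcoef b η hb hη hbη) hK
  have h3 : (#{e ∈ incidentPairs φ.support | sortedImage φ e = e} : ℝ) ≤ #φ.support := by
    exact_mod_cast card_filter_sortedImage_le φ
  have h4 := mul_le_mul_of_nonneg_left h3 ((sq_nonneg a).trans haρ)
  push_cast
  linarith

end Deviation

section ErrorEvent

variable {n d : ℕ} {a b ρ η κ ε : ℝ}

/-- The event that the true matching scores atypically low on `D`, or that some matching moving
exactly the vertices of `D` scores atypically high there. -/
def badEvent (d : ℕ) (a b ρ η κ : ℝ) (D : Finset (Fin n)) : Set (Samp n d) :=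
  {ω | score a b ρ η D 1 ω ≤ (1 - κ) * signal d a b ρ η D} ∪
    ⋃ φ ∈ ({φ | φ.support = D} : Finset (Equiv.Perm (Fin n))),
      {ω | (1 - κ) * signal d a b ρ η D ≤ score a b ρ η D φ ω}

lemma card_filter_support_eq_le (D : Finset (Fin n)) :
    #({φ | φ.support = D} : Finset (Equiv.Perm (Fin n))) ≤ n ^ #D := by
  have h : Fintype.card (D → Fin n) = n ^ #D := by simp
  rw [← h, ← Finset.card_univ]
  refine Finset.card_le_card_of_injOn (fun φ (i : D) => φ i) (fun _ _ => Finset.mem_univ _) ?_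
  intro φ hφ ψ hψ hEq
  simp only [Finset.coe_filter, Finset.mem_univ, true_and, Set.mem_ofPred_eq] at hφ hψ
  ext i
  by_cases hi : i ∈ D
  · exact congrArg Fin.val (congrFun hEq ⟨i, hi⟩)
  · rw [Equiv.Perm.notMem_support.1 (hφ ▸ hi), Equiv.Perm.notMem_support.1 (hψ ▸ hi)]

lemma le_signal (D : Finset (Fin n)) (hn : 1 ≤ n) (hκn : 2 ≤ κ * (n - 1)) (hκ0 : 0 < κ)
    (hκ : κ ≤ 1 / 8) (haρ : a ^ 2 ≤ a * ρ) (hbη : b ^ 2 ≤ b * η)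
    (hsig : 4 * (1 + ε) * (1 - κ ^ 2) * Real.log n ≤ a ^ 2 * n + 2 * b ^ 2 * d) :
    2 * (1 + ε) * (1 - κ ^ 2) * (1 - κ) * (#D * Real.log n) ≤ signal d a b ρ η D ∧
      a * ρ * #D ≤ κ * signal d a b ρ η D := by
  have hN : (#D : ℝ) * (n - 1) ≤ 2 * #(incidentPairs D) := by
    have h := card_mul_le_two_mul_card_incidentPairs D
    rw [← Nat.cast_one, ← Nat.cast_sub hn]
    exact_mod_cast h
  have hK : (0 : ℝ) ≤ #D := Nat.cast_nonneg _
  have hd0 : (0 : ℝ) ≤ d := Nat.cast_nonneg _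
  have hu : 0 ≤ a * ρ := (sq_nonneg a).trans haρ
  have hv : 0 ≤ b * η := (sq_nonneg b).trans hbη
  have hKd : 0 ≤ (#D : ℝ) * d := mul_nonneg hK hd0
  have hNn : (0 : ℝ) ≤ #(incidentPairs D) := Nat.cast_nonneg _
  rw [signal]
  constructor
  · have h1 : a ^ 2 * #(incidentPairs D) ≤ a * ρ * #(incidentPairs D) :=
      mul_le_mul_of_nonneg_right haρ hNn
    have h2 : b ^ 2 * (#D * d) ≤ b * η * (#D * d) := mul_le_mul_of_nonneg_right hbη hKd
    have h3 : a ^ 2 * (#D * (n - 1)) ≤ a ^ 2 * (2 * #(incidentPairs D)) :=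
      mul_le_mul_of_nonneg_left hN (sq_nonneg a)
    have h4 : (1 - κ) * n ≤ n - 1 := by nlinarith
    have h5 : a ^ 2 * #D * ((1 - κ) * n) ≤ a ^ 2 * #D * (n - 1) :=
      mul_le_mul_of_nonneg_left h4 (by positivity)
    have h6 : #D * (1 - κ) * (4 * (1 + ε) * (1 - κ ^ 2) * Real.log n) ≤
        #D * (1 - κ) * (a ^ 2 * n + 2 * b ^ 2 * d) :=
      mul_le_mul_of_nonneg_left hsig (mul_nonneg hK (by linarith))
    have h7 : 0 ≤ κ * (b ^ 2 * (#D * d)) := by positivity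
    nlinarith
  · have h1 : a * ρ * #D * 2 ≤ a * ρ * #D * (κ * (n - 1)) :=
      mul_le_mul_of_nonneg_left hκn (mul_nonneg hu hK)
    have h2 : κ * (a * ρ) * (#D * (n - 1)) ≤ κ * (a * ρ) * (2 * #(incidentPairs D)) :=
      mul_le_mul_of_nonneg_left hN (by positivity)
    have h3 : 0 ≤ κ * (b * η * (#D * d)) := by positivity
    nlinarith

lemma measure_badEvent_le (D : Finset (Fin n)) (hn : 1 ≤ n) (hκn : 2 ≤ κ * (n - 1)) (hε : 0 < ε)
    (hκ : κ = ε / (52 * (1 + ε))) (ha : |a| ≤ κ) (hb : |b| ≤ κ) (hρ : |ρ| ≤ 1) (hη : |η| ≤ 1)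
    (haρ : a ^ 2 ≤ a * ρ) (hbη : b ^ 2 ≤ b * η)
    (hsig : 4 * (1 + ε) * (1 - κ ^ 2) * Real.log n ≤ a ^ 2 * n + 2 * b ^ 2 * d) :
    μ n d (badEvent d a b ρ η κ D) ≤
      ENNReal.ofReal (2 * exp (-(κ ^ 2 / 44) * (#D * Real.log n))) := by
  have hκ0 : 0 < κ := by rw [hκ]; positivity
  have hκε : 52 * κ * (1 + ε) = ε := by rw [hκ]; field_simp
  have hκ1 : κ ≤ 1 / 52 := by nlinarith
  have hκ8 : κ ≤ 1 / 8 := by linarith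
  obtain ⟨hm, hak⟩ := le_signal D hn hκn hκ0 hκ8 haρ hbη hsig
  set m := signal d a b ρ η D with hmdef
  set x := (#D : ℝ) * Real.log n with hx
  have hx0 : 0 ≤ x := mul_nonneg (Nat.cast_nonneg _) (Real.log_natCast_nonneg n)
  have hκε2 : κ ≤ ε / 2 := by nlinarith
  have hfac : 1 - 2 * κ ≤ (1 - κ ^ 2) * (1 - κ) := by nlinarith [pow_pos hκ0 3]
  have hm1 : 2 * (1 + ε) * (1 - 2 * κ) * x ≤ m := by
    refine le_trans ?_ hm
    have := mul_le_mul_of_nonneg_right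
      (mul_le_mul_of_nonneg_left hfac (show 0 ≤ 2 * (1 + ε) by linarith)) hx0
    linarith
  have hxm : x ≤ m := by
    refine le_trans (le_mul_of_one_le_left hx0 ?_) hm1
    nlinarith
  have h1 : μ n d {ω | score a b ρ η D 1 ω ≤ (1 - κ) * m} ≤
      ENNReal.ofReal (exp (-(κ ^ 2 / 44) * x)) := by
    refine (measure_score_one_le D hκ0 hκ8 ha hb hρ hη haρ hbη).trans
      (ENNReal.ofReal_le_ofReal (Real.exp_le_exp.2 ?_))
    have := mul_le_mul_of_nonneg_left hxm (show 0 ≤ κ ^ 2 / 44 by positivity)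
    linarith
  have h2 : ∀ φ ∈ ({φ | φ.support = D} : Finset (Equiv.Perm (Fin n))),
      μ n d {ω | (1 - κ) * m ≤ score a b ρ η D φ ω} ≤
        ENNReal.ofReal (exp (-(ε / 2) * x - x)) := by
    intro φ hφ
    obtain rfl := (Finset.mem_filter.1 hφ).2
    refine (measure_score_ge_le φ hκ8 ha hb hρ hη haρ hbη).trans
      (ENNReal.ofReal_le_ofReal (Real.exp_le_exp.2 ?_))
    have h3 := mul_le_mul_of_nonneg_left hm1 (show 0 ≤ 1 / 2 - 12 * κ by linarith)
    have h5 : 1 + ε / 2 ≤ (1 / 2 - 12 * κ) * (2 * (1 + ε) * (1 - 2 * κ)) := by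
      nlinarith [mul_nonneg (sq_nonneg κ) hε.le, sq_nonneg κ]
    have h4 : (1 + ε / 2) * x ≤ (1 / 2 - 12 * κ) * (2 * (1 + ε) * (1 - 2 * κ) * x) := by
      have := mul_le_mul_of_nonneg_right h5 hx0
      linarith
    linarith
  have h3 : μ n d (⋃ φ ∈ ({φ | φ.support = D} : Finset (Equiv.Perm (Fin n))),
      {ω | (1 - κ) * m ≤ score a b ρ η D φ ω}) ≤
        ENNReal.ofReal (exp (-(κ ^ 2 / 44) * x)) := by
    refine (measure_biUnion_finset_le _ _).trans ((Finset.sum_le_sum h2).trans ?_)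
    rw [Finset.sum_const, nsmul_eq_mul, ← ENNReal.ofReal_natCast,
      ← ENNReal.ofReal_mul (Nat.cast_nonneg _)]
    refine ENNReal.ofReal_le_ofReal ?_
    have hcard : (#({φ | φ.support = D} : Finset (Equiv.Perm (Fin n))) : ℝ) ≤ exp x := by
      have hn0 : (0 : ℝ) < n := by exact_mod_cast hn
      rw [hx, Real.exp_nat_mul, Real.exp_log hn0]
      exact_mod_cast card_filter_support_eq_le D
    calc _ ≤ exp x * exp (-(ε / 2) * x - x) := by gcongr
      _ = exp (-(ε / 2) * x) := by rw [← Real.exp_add]; ring_nf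
      _ ≤ _ := by
        refine Real.exp_le_exp.2 ?_
        have : κ ^ 2 / 44 ≤ ε / 2 := by nlinarith
        nlinarith [mul_le_mul_of_nonneg_right this hx0]
  refine (measure_union_le _ _).trans ((add_le_add h1 h3).trans (le_of_eq ?_))
  rw [← ENNReal.ofReal_add (exp_pos _).le (exp_pos _).le, ← two_mul]

lemma measure_iUnion_badEvent_le {δ : ℝ} (hn : 1 ≤ n) (hκn : 2 ≤ κ * (n - 1)) (hε : 0 < ε)
    (hκ : κ = ε / (52 * (1 + ε))) (ha : |a| ≤ κ) (hb : |b| ≤ κ) (hρ : |ρ| ≤ 1) (hη : |η| ≤ 1)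
    (haρ : a ^ 2 ≤ a * ρ) (hbη : b ^ 2 ≤ b * η)
    (hsig : 4 * (1 + ε) * (1 - κ ^ 2) * Real.log n ≤ a ^ 2 * n + 2 * b ^ 2 * d) :
    μ n d (⋃ D ∈ ({D | (1 - δ) * n ≤ #D} : Finset (Finset (Fin n))),
      badEvent d a b ρ η κ D) ≤
      ENNReal.ofReal (2 ^ n * (2 * exp (-(κ ^ 2 / 44) * ((1 - δ) * n * Real.log n)))) := by
  have h1 : ∀ D ∈ ({D | (1 - δ) * n ≤ #D} : Finset (Finset (Fin n))),
      μ n d (badEvent d a b ρ η κ D) ≤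
        ENNReal.ofReal (2 * exp (-(κ ^ 2 / 44) * ((1 - δ) * n * Real.log n))) := by
    intro D hD
    have hD2 := (Finset.mem_filter.1 hD).2
    refine (measure_badEvent_le D hn hκn hε hκ ha hb hρ hη haρ hbη hsig).trans
      (ENNReal.ofReal_le_ofReal ?_)
    have h2 := mul_le_mul_of_nonneg_left
      (mul_le_mul_of_nonneg_right hD2 (Real.log_natCast_nonneg n))
      (show 0 ≤ κ ^ 2 / 44 by positivity)
    have h3 := Real.exp_le_exp.2 (neg_le_neg h2)
    simp only [neg_mul]
    linarith
  refine (measure_biUnion_finset_le _ _).trans ((Finset.sum_le_sum h1).trans ?_)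
  rw [Finset.sum_const, nsmul_eq_mul, ← ENNReal.ofReal_natCast,
    ← ENNReal.ofReal_mul (Nat.cast_nonneg _)]
  refine ENNReal.ofReal_le_ofReal (mul_le_mul_of_nonneg_right ?_ (by positivity))
  have h4 := Finset.card_le_univ ({D | (1 - δ) * n ≤ #D} : Finset (Finset (Fin n)))
  rw [Fintype.card_finset, Fintype.card_fin] at h4
  exact_mod_cast h4

end ErrorEvent

section Estimator

variable {n d : ℕ} {a b ρ η κ δ : ℝ}

instance : IsProbabilityMeasure (unifPerm n) := by unfold unifPerm; infer_instance

instance : IsProbabilityMeasure (μU n d) := by unfold μU; infer_instance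

/-- A finite family of measurable functions has a measurable selection of maximizers. -/
lemma exists_measurable_argmax {Ω P : Type*} [MeasurableSpace Ω] [MeasurableSpace P] [Fintype P]
    [Nonempty P] [DiscreteMeasurableSpace P] {L : P → Ω → ℝ} (hL : ∀ p, Measurable (L p)) :
    ∃ s : Ω → P, Measurable s ∧ ∀ ω p, L p ω ≤ L (s ω) ω := by
  classical
  have key : ∀ t : Finset P, ∃ s : Ω → P, Measurable s ∧ ∀ ω, ∀ p ∈ t, L p ω ≤ L (s ω) ω := by
    intro t
    induction t using Finset.induction with
    | empty => exact ⟨fun _ => Classical.arbitrary P, measurable_const, by simp⟩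
    | insert p t _ ih =>
      obtain ⟨s, hs, hmax⟩ := ih
      have hLs : Measurable fun ω => L (s ω) ω :=
        (measurable_from_prod_countable_right (f := fun q : P × Ω => L q.1 q.2) hL).comp
          (hs.prodMk measurable_id)
      refine ⟨fun ω => if L (s ω) ω < L p ω then p else s ω,
        Measurable.ite (measurableSet_lt hLs (hL p)) measurable_const hs, fun ω q hq => ?_⟩
      rcases Finset.mem_insert.1 hq with rfl | hq
      · by_cases h : L (s ω) ω < L q ω
        · simp [h]
        · simp only [if_neg h]
          exact not_lt.1 h
      · have h1 := hmax ω q hq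
        by_cases h : L (s ω) ω < L p ω
        · simpa [h] using h1.trans h.le
        · simpa [h] using h1
  obtain ⟨s, hs, hmax⟩ := key Finset.univ
  exact ⟨s, hs, fun ω p => hmax ω p (Finset.mem_univ p)⟩

/-- The weighted alignment of the two observed networks under the matching `φ`. -/
def alignment (a b : ℝ) (φ : Equiv.Perm (Fin n)) (o : Obs n d) : ℝ :=
  a * ∑ p ∈ incidentPairs Finset.univ, o.2.1 (φ p.1) (φ p.2) * o.1 p.1 p.2 +
    b * ∑ i, ∑ j, o.2.2.2 (φ i) j * o.2.2.1 i j

lemma measurable_alignment (a b : ℝ) (φ : Equiv.Perm (Fin n)) :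
    Measurable (alignment a b φ : Obs n d → ℝ) := by
  unfold alignment
  fun_prop

lemma alignment_obs (a b ρ η : ℝ) (φ : Equiv.Perm (Fin n)) (ω : SampU n d) :
    alignment a b φ (obs ρ η ω) = score a b ρ η Finset.univ (ω.2⁻¹ * φ) ω.1 := rfl

lemma score_univ_sub_score_univ_one (a b ρ η : ℝ) (φ : Equiv.Perm (Fin n)) (ω : Samp n d) :
    score a b ρ η Finset.univ φ ω - score a b ρ η Finset.univ 1 ω =
      score a b ρ η φ.support φ ω - score a b ρ η φ.support 1 ω := by
  have h1 : ∑ p ∈ incidentPairs φ.support,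
      (Bmat ρ ω (φ p.1) (φ p.2) * Amat ω p.1 p.2 - Bmat ρ ω p.1 p.2 * Amat ω p.1 p.2) =
      ∑ p ∈ incidentPairs Finset.univ,
        (Bmat ρ ω (φ p.1) (φ p.2) * Amat ω p.1 p.2 - Bmat ρ ω p.1 p.2 * Amat ω p.1 p.2) := by
    refine Finset.sum_subset (fun p hp => ?_) (fun p hp hp' => ?_)
    · simp only [incidentPairs, Finset.mem_filter] at hp ⊢
      simpa using hp.2.1
    · simp only [incidentPairs, Finset.mem_filter, Finset.mem_univ, true_and, true_or, and_true,
        not_and, not_or, Equiv.Perm.notMem_support] at hp hp'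
      rw [(hp' hp).1, (hp' hp).2, sub_self]
  have h2 : ∑ i ∈ φ.support,
      (∑ j, Ymat η ω (φ i) j * Xmat ω i j - ∑ j, Ymat η ω i j * Xmat ω i j) =
      ∑ i, (∑ j, Ymat η ω (φ i) j * Xmat ω i j - ∑ j, Ymat η ω i j * Xmat ω i j) := by
    refine Finset.sum_subset (Finset.subset_univ _) (fun i _ hi => ?_)
    rw [Equiv.Perm.notMem_support.1 hi, sub_self]
  rw [Finset.sum_sub_distrib, Finset.sum_sub_distrib] at h1 h2
  simp only [score, Equiv.Perm.one_apply]
  linear_combination -a * h1 - b * h2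

lemma card_support_inv_mul (hn : 1 ≤ n) {φ ψ : Equiv.Perm (Fin n)} (h : ov φ ψ ≤ δ) :
    (1 - δ) * n ≤ #(ψ⁻¹ * φ).support := by
  have hn0 : (0 : ℝ) < n := by exact_mod_cast hn
  rw [ov, div_le_iff₀ hn0] at h
  have h1 : (ψ⁻¹ * φ).support = ({i | ¬ φ i = ψ i} : Finset (Fin n)) := by
    ext i
    rw [Equiv.Perm.mem_support, Equiv.Perm.mul_apply, Ne, Equiv.Perm.inv_eq_iff_eq]
    simp
  have h2 := Finset.card_filter_add_card_filter_not (s := (Finset.univ : Finset (Fin n)))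
    (fun i => φ i = ψ i)
  rw [Finset.card_univ, Fintype.card_fin] at h2
  have h3 : (#({i | φ i = ψ i} : Finset (Fin n)) : ℝ) +
      #({i | ¬ φ i = ψ i} : Finset (Fin n)) = n := by exact_mod_cast h2
  rw [h1]
  linarith

/-- If an alignment maximizer has small overlap with the truth, then a bad event occurs on a
large vertex set. -/
lemma mem_iUnion_badEvent (hn : 1 ≤ n) (ω : SampU n d) {φ : Equiv.Perm (Fin n)}
    (hmax : ∀ ψ, alignment a b ψ (obs ρ η ω) ≤ alignment a b φ (obs ρ η ω))
    (h : ov φ (πstar ω) ≤ δ) :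
    ω.1 ∈ ⋃ D ∈ ({D | (1 - δ) * n ≤ #D} : Finset (Finset (Fin n))), badEvent d a b ρ η κ D := by
  have h1 := hmax ω.2
  rw [alignment_obs, alignment_obs, inv_mul_cancel] at h1
  have h2 := score_univ_sub_score_univ_one a b ρ η (ω.2⁻¹ * φ) ω.1
  refine Set.mem_iUnion₂.2 ⟨(ω.2⁻¹ * φ).support,
    Finset.mem_filter.2 ⟨Finset.mem_univ _, card_support_inv_mul hn h⟩, ?_⟩
  rcases le_total (score a b ρ η (ω.2⁻¹ * φ).support 1 ω.1)
    ((1 - κ) * signal d a b ρ η (ω.2⁻¹ * φ).support) with h3 | h3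
  · exact Or.inl h3
  · refine Or.inr (Set.mem_iUnion₂.2 ⟨ω.2⁻¹ * φ, by simp, ?_⟩)
    exact h3.trans (by linarith)

lemma one_sub_le_measure_overlap (hn : 1 ≤ n) {est : Obs n d → Equiv.Perm (Fin n)}
    (hmax : ∀ o φ, alignment a b φ o ≤ alignment a b (est o) o) (κ : ℝ) :
    1 - μ n d (⋃ D ∈ ({D | (1 - δ) * n ≤ #D} : Finset (Finset (Fin n))),
      badEvent d a b ρ η κ D) ≤ μU n d {ω | δ < ov (est (obs ρ η ω)) (πstar ω)} := by
  set S := ⋃ D ∈ ({D | (1 - δ) * n ≤ #D} : Finset (Finset (Fin n))), badEvent d a b ρ η κ D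
  rw [tsub_le_iff_right]
  have h1 : μU n d (S ×ˢ Set.univ) = μ n d S := by
    rw [μU, Measure.prod_prod, measure_univ, mul_one]
  rw [← h1, ← measure_univ (μ := μU n d)]
  refine (measure_mono fun ω _ => ?_).trans (measure_union_le _ _)
  rcases lt_or_ge δ (ov (est (obs ρ η ω)) (πstar ω)) with h | h
  · exact Or.inl h
  · exact Or.inr ⟨mem_iUnion_badEvent hn ω (hmax _) h, Set.mem_univ _⟩

end Estimator

section Asymptotics

/-- Truncation of `r` to the interval `[-κ, κ]`. -/
def clip (κ r : ℝ) : ℝ := max (-κ) (min κ r)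

variable {κ r : ℝ}

lemma abs_clip_le (hκ : 0 ≤ κ) (r : ℝ) : |clip κ r| ≤ κ :=
  abs_le.2 ⟨le_max_left _ _, max_le (by linarith) (min_le_left _ _)⟩

lemma clip_sq_le (hκ : 0 ≤ κ) (r : ℝ) : clip κ r ^ 2 ≤ clip κ r * r := by
  rw [clip]
  rcases le_total κ r with h | h
  · rw [min_eq_left h, max_eq_right (by linarith)]
    nlinarith
  · rw [min_eq_right h]
    rcases le_total (-κ) r with h' | h'
    · rw [max_eq_right h', sq]
    · rw [max_eq_left h']
      nlinarith

lemma clip_of_abs_le (h : |r| ≤ κ) : clip κ r = r := by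
  rw [clip, min_eq_right (abs_le.1 h).2, max_eq_right (abs_le.1 h).1]

lemma clip_sq_of_lt_abs (hκ : 0 ≤ κ) (h : κ < |r|) : clip κ r ^ 2 = κ ^ 2 := by
  rw [clip]
  rcases lt_abs.1 h with h | h
  · rw [min_eq_left h.le, max_eq_right (by linarith)]
  · rw [min_eq_right (by linarith), max_eq_left (by linarith), neg_sq]

lemma mul_sq_div_le_clip_sq (hκ : 0 ≤ κ) (hκ1 : κ < 1) (h : |r| ≤ κ) {x : ℝ} (hx : 0 ≤ x) :
    (1 - κ ^ 2) * (r ^ 2 * x / (1 - r ^ 2)) ≤ clip κ r ^ 2 * x := by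
  rw [clip_of_abs_le h]
  have h1 : r ^ 2 ≤ κ ^ 2 := sq_le_sq' (abs_le.1 h).1 (abs_le.1 h).2
  have h2 : 0 < 1 - r ^ 2 := by nlinarith
  rw [mul_div_assoc', div_le_iff₀ h2, mul_comm]
  exact mul_le_mul_of_nonneg_left (by linarith) (by positivity)

lemma le_clip_signal {ρ η n d L : ℝ} (hκ : 0 ≤ κ) (hκ1 : κ < 1) (hn : 0 ≤ n) (hd : 0 ≤ d)
    (hL : 0 ≤ L) (h : L ≤ ρ ^ 2 * n / (1 - ρ ^ 2) + 2 * η ^ 2 * d / (1 - η ^ 2))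
    (h1 : L ≤ κ ^ 2 * n) (h2 : L ≤ 2 * κ ^ 2 * d) :
    (1 - κ ^ 2) * L ≤ clip κ ρ ^ 2 * n + 2 * clip κ η ^ 2 * d := by
  have h3 : 0 ≤ κ ^ 2 * L := by positivity
  have h4 : 0 ≤ clip κ ρ ^ 2 * n := by positivity
  have h5 : 0 ≤ clip κ η ^ 2 * d := by positivity
  rcases le_or_gt |ρ| κ with hρ | hρ
  · rcases le_or_gt |η| κ with hη | hη
    · have h6 := mul_sq_div_le_clip_sq hκ hκ1 hρ hn
      have h7 := mul_sq_div_le_clip_sq hκ hκ1 hη (x := 2 * d) (by positivity)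
      have h8 := mul_le_mul_of_nonneg_left h (show 0 ≤ 1 - κ ^ 2 by nlinarith)
      rw [mul_add, mul_comm 2 (η ^ 2), mul_assoc (η ^ 2)] at h8
      linarith
    · rw [clip_sq_of_lt_abs hκ hη]
      linarith
  · rw [clip_sq_of_lt_abs hκ hρ]
    linarith

lemma tendsto_two_pow_mul_exp_neg {g : ℝ} (hg : 0 < g) :
    Tendsto (fun n : ℕ => (2 : ℝ) ^ n * (2 * exp (-g * (n * Real.log n)))) atTop (𝓝 0) := by
  have hlog : ∀ᶠ n : ℕ in atTop, (Real.log 2 + 1) / g ≤ Real.log n :=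
    (Real.tendsto_log_atTop.comp tendsto_natCast_atTop_atTop).eventually_ge_atTop _
  have hlim : Tendsto (fun n : ℕ => 2 * exp (-(n : ℝ))) atTop (𝓝 0) := by
    simpa using
      ((Real.tendsto_exp_neg_atTop_nhds_zero.comp tendsto_natCast_atTop_atTop).const_mul 2)
  refine squeeze_zero' (Eventually.of_forall fun n => by positivity) ?_ hlim
  filter_upwards [hlog] with n hn
  rw [div_le_iff₀ hg] at hn
  have h2 : (2 : ℝ) ^ n = exp (n * Real.log 2) := by
    rw [Real.exp_nat_mul, Real.exp_log two_pos]
  rw [h2, mul_left_comm, ← Real.exp_add]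
  refine mul_le_mul_of_nonneg_left (Real.exp_le_exp.2 ?_) two_pos.le
  have := mul_le_mul_of_nonneg_left hn (Nat.cast_nonneg (α := ℝ) n)
  linarith

end Asymptotics

end CGM

/-- **Almost exact recovery, achievability.**  If `d = ω(log n)` and for some `ε > 0` and
all sufficiently large `n` one has `ρ²n/(1−ρ²) + 2η²d/(1−η²) ≥ 4(1+ε) log n`, then there
is a (measurable) estimator `π̂(A,B,X,Y)` such that for every `δ ∈ (0,1)`,
`P(ov(π̂,π*) > δ) = 1 − o(1)`. -/
theorem almost_exact_recovery_achievability
    (d : ℕ → ℕ) (ρ η : ℕ → ℝ)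
    (hρ : ∀ n, ρ n ∈ Set.Icc (-1 : ℝ) 1) (hη : ∀ n, η n ∈ Set.Icc (-1 : ℝ) 1)
    (hd : Tendsto (fun n : ℕ => (d n : ℝ) / Real.log n) atTop atTop)
    (hsig : ∃ ε > (0 : ℝ), ∀ᶠ n : ℕ in atTop,
      4 * (1 + ε) * Real.log n ≤
        (ρ n) ^ 2 * n / (1 - (ρ n) ^ 2) + 2 * (η n) ^ 2 * (d n) / (1 - (η n) ^ 2)) :
    ∃ est : (n : ℕ) → CGM.Obs n (d n) → Equiv.Perm (Fin n),
      (∀ n, Measurable (est n)) ∧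
      ∀ δ ∈ Set.Ioo (0 : ℝ) 1,
        Tendsto
          (fun n => CGM.μU n (d n)
            {ω | δ < CGM.ov (est n (CGM.obs (ρ n) (η n) ω)) (CGM.πstar ω)})
          atTop (𝓝 1) := by
  obtain ⟨ε, hε, hsig⟩ := hsig
  set κ := ε / (52 * (1 + ε)) with hκ
  have hκ0 : 0 < κ := by positivity
  have hκ1 : κ < 1 := by
    rw [hκ, div_lt_one (by positivity)]
    linarith
  choose est hmeas hmax using fun n => CGM.exists_measurable_argmax fun φ : Equiv.Perm (Fin n) =>
    CGM.measurable_alignment (d := d n) (CGM.clip κ (ρ n)) (CGM.clip κ (η n)) φ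
  refine ⟨est, hmeas, fun δ hδ => ?_⟩
  have hcast : Tendsto (fun n : ℕ => (n : ℝ)) atTop atTop := tendsto_natCast_atTop_atTop
  have hloglin : ∀ᶠ n : ℕ in atTop, 4 * (1 + ε) * Real.log n ≤ κ ^ 2 * n := by
    have h := (Real.isLittleO_log_id_atTop.comp_tendsto hcast).bound
      (show 0 < κ ^ 2 / (4 * (1 + ε)) by positivity)
    filter_upwards [h] with n hn
    have h2 : Real.log n ≤ κ ^ 2 / (4 * (1 + ε)) * n := by
      simpa using (le_abs_self _).trans hn
    rw [div_mul_eq_mul_div, le_div_iff₀ (by positivity)] at h2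
    linarith
  have hdlog : ∀ᶠ n : ℕ in atTop, 4 * (1 + ε) * Real.log n ≤ 2 * κ ^ 2 * d n := by
    filter_upwards [hd.eventually_ge_atTop (4 * (1 + ε) / (2 * κ ^ 2)),
      (Real.tendsto_log_atTop.comp hcast).eventually_gt_atTop 0] with n h1 h2
    rw [div_le_div_iff₀ (by positivity) (show 0 < Real.log n from h2)] at h1
    linarith
  have hbound : ∀ᶠ n : ℕ in atTop,
      1 - ENNReal.ofReal (2 ^ n * (2 * exp (-(κ ^ 2 / 44 * (1 - δ)) * (n * Real.log n)))) ≤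
        CGM.μU n (d n)
          {ω | δ < CGM.ov (est n (CGM.obs (ρ n) (η n) ω)) (CGM.πstar ω)} := by
    filter_upwards [hsig, hloglin, hdlog, eventually_ge_atTop 1,
      hcast.eventually_ge_atTop (2 / κ + 1)] with n h1 h2 h3 h4 h5
    have h6 : 2 ≤ κ * ((n : ℝ) - 1) := by
      rw [mul_comm, ← div_le_iff₀ hκ0]
      linarith
    have h7 : 4 * (1 + ε) * (1 - κ ^ 2) * Real.log n ≤
        CGM.clip κ (ρ n) ^ 2 * n + 2 * CGM.clip κ (η n) ^ 2 * d n := by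
      have := CGM.le_clip_signal hκ0.le hκ1 (Nat.cast_nonneg n) (Nat.cast_nonneg (d n))
        (mul_nonneg (by positivity) (Real.log_natCast_nonneg n)) h1 h2 h3
      linarith
    have h8 := CGM.measure_iUnion_badEvent_le (δ := δ) h4 h6 hε hκ
      (CGM.abs_clip_le hκ0.le (ρ n)) (CGM.abs_clip_le hκ0.le (η n)) (abs_le.2 (hρ n))
      (abs_le.2 (hη n)) (CGM.clip_sq_le hκ0.le (ρ n)) (CGM.clip_sq_le hκ0.le (η n)) h7
    refine le_trans (tsub_le_tsub_left (h8.trans (le_of_eq ?_)) 1)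
      (CGM.one_sub_le_measure_overlap h4 (hmax n) κ)
    ring_nf
  have hlim : Tendsto (fun n : ℕ => 1 - ENNReal.ofReal
      (2 ^ n * (2 * exp (-(κ ^ 2 / 44 * (1 - δ)) * (n * Real.log n))))) atTop (𝓝 1) := by
    have h := ENNReal.Tendsto.sub (tendsto_const_nhds (x := (1 : ENNReal)))
      (ENNReal.tendsto_ofReal (CGM.tendsto_two_pow_mul_exp_neg
        (mul_pos (show 0 < κ ^ 2 / 44 by positivity) (sub_pos.2 hδ.2))))
      (Or.inl ENNReal.one_ne_top)
    simpa using h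
  exact tendsto_of_tendsto_of_tendsto_of_le_of_le' hlim tendsto_const_nhds hbound
    (Eventually.of_forall fun n => prob_le_one)
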